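/- Consider the uncertain discrete-time network model under assumptions (H1), (H2), (H3), (H4). Assume the existence of a point x* ∈ S with x_i* ∈ (0,μ_i) for all i and a vector v* ∈ ℝ₊ⁿ with v_i* < min(v_i^max, min{g_i(d,0) : d ∈ D}) for all i, satisfying f_i(d,x_i*) = v_i* + Σ_{j=1}^n p_{j,i} f_j(d,x_j*) for all i and all d ∈ D. Then there exist an index set R ⊆ {i ∈ {1,…,n} : v_i* > 0}, a non-negative matrix K ∈ ℝ₊^{n×n} and a vector b ∈ ℝ₊ⁿ with 0 < b_i < v_i* for i ∈ R and b_i = v_i* for i ∉ R, such that for every τ ∈ (0,1), the point x* is Robustly Globally Exponentially Stable for the closed-loop system obtained from the network update with the inflow v given by the feedback law (3.3). -/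

import Mathlib

open Matrix

/-- The state set `S = [0,a₁] × ⋯ × [0,aₙ]`. -/
def stateSet {n : ℕ} (a : Fin n → ℝ) : Set (Fin n → ℝ) :=
  {x | ∀ i, x i ∈ Set.Icc 0 (a i)}

/-- The Euclidean norm of `x ∈ ℝⁿ`. -/
noncomputable def euclNorm {n : ℕ} (x : Fin n → ℝ) : ℝ :=
  Real.sqrt (∑ i, x i ^ 2)

/-- The map `h(x) = (max(0,x₁),…,max(0,xₙ))'`. -/
def posVec {n : ℕ} (x : Fin n → ℝ) : Fin n → ℝ :=
  fun i => max 0 (x i)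

/-- The general uncertain, discrete-time network model (2.9): `n` cells with
capacities `a i`, a non-empty compact disturbance set `D ⊆ ℝˡ`, demand functions
`f`, congestion functions `s`, inflow functions `w`, turning rates `p`, exit
rates `Q` and supply functions `g`, satisfying the standing modelling
assumptions, including (2.7) and (2.8). -/
structure Network (n l : ℕ) where
  /-- storage capacities -/
  a : Fin n → ℝ
  ha : ∀ i, 0 < a i
  /-- the disturbance set -/
  D : Set (Fin l → ℝ)
  hD : D.Nonempty
  hD_compact : IsCompact D
  /-- demand functions `f i : D × [0, a i] → ℝ₊` -/
  f : Fin n → (Fin l → ℝ) → ℝ → ℝ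
  /-- congestion functions `s i : D × S × ℝ₊ⁿ → [0,1]` -/
  s : Fin n → (Fin l → ℝ) → (Fin n → ℝ) → (Fin n → ℝ) → ℝ
  /-- inflow functions `w i : D × S × ℝ₊ⁿ → [0,1]` -/
  w : Fin n → (Fin l → ℝ) → (Fin n → ℝ) → (Fin n → ℝ) → ℝ
  /-- turning rates -/
  p : Fin n → Fin n → ℝ
  /-- exit rates -/
  Q : Fin n → ℝ
  /-- supply functions `g i : D × S → ℝ₊` -/
  g : Fin n → (Fin l → ℝ) → (Fin n → ℝ) → ℝ
  hf_nonneg : ∀ i, ∀ d ∈ D, ∀ z ∈ Set.Icc (0 : ℝ) (a i), 0 ≤ f i d z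
  hf_le : ∀ i, ∀ d ∈ D, ∀ z ∈ Set.Icc (0 : ℝ) (a i), f i d z ≤ z
  hs01 : ∀ i, ∀ d ∈ D, ∀ x ∈ stateSet a, ∀ v : Fin n → ℝ, (∀ j, 0 ≤ v j) →
    s i d x v ∈ Set.Icc (0 : ℝ) 1
  hw01 : ∀ i, ∀ d ∈ D, ∀ x ∈ stateSet a, ∀ v : Fin n → ℝ, (∀ j, 0 ≤ v j) →
    w i d x v ∈ Set.Icc (0 : ℝ) 1
  hp_nonneg : ∀ i j, 0 ≤ p i j
  hp_diag : ∀ i, p i i = 0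
  hQ_nonneg : ∀ i, 0 ≤ Q i
  /-- (2.5): `∑ j, p i j + Q i = 1` -/
  hpQ : ∀ i, (∑ j, p i j) + Q i = 1
  hg_cont : ∀ i, ContinuousOn (fun q : (Fin l → ℝ) × (Fin n → ℝ) => g i q.1 q.2)
    (D ×ˢ stateSet a)
  hg_nonneg : ∀ i, ∀ d ∈ D, ∀ x ∈ stateSet a, 0 ≤ g i d x
  hg_pos : ∀ i, ∀ d ∈ D, ∀ x ∈ stateSet a, x i < a i →
    0 < g i d x ∧ g i d x ≤ a i - x i
  /-- (2.7): the total inflow of each cell is bounded by its supply -/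
  h27 : ∀ i, ∀ d ∈ D, ∀ x ∈ stateSet a, ∀ v : Fin n → ℝ, (∀ j, 0 ≤ v j) →
    w i d x v * v i + ∑ j, p j i * (s j d x v * f j d (x j)) ≤ g i d x
  /-- (2.8): if every attempted total inflow can be accommodated, no congestion -/
  h28 : ∀ d ∈ D, ∀ x ∈ stateSet a, ∀ v : Fin n → ℝ, (∀ j, 0 ≤ v j) →
    (∀ i, v i + ∑ j, p j i * f j d (x j) ≤ g i d x) →
    ∀ i, w i d x v = 1 ∧ s i d x v = 1

/-- The state update map (2.9):
`x i ⁺ = x i + w i v i − s i f i (x i) + ∑ j, p j i * s j * f j (x j)`. -/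
def Network.update {n l : ℕ} (N : Network n l) (d : Fin l → ℝ)
    (x v : Fin n → ℝ) : Fin n → ℝ :=
  fun i => x i + N.w i d x v * v i - N.s i d x v * N.f i d (x i)
    + ∑ j, N.p j i * (N.s j d x v * N.f j d (x j))

/-- Assumption (H1) on the demand functions. -/
structure H1 {n l : ℕ} (N : Network n l) where
  /-- critical densities -/
  δ : Fin n → ℝ
  δt : Fin n → ℝ
  L : Fin n → ℝ
  G : Fin n → ℝ
  fmin : Fin n → ℝ
  hδ : ∀ i, δ i ∈ Set.Ioc 0 (N.a i)
  hδt : ∀ i, δt i ∈ Set.Ioc 0 (δ i)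
  hL : ∀ i, L i ∈ Set.Ioo (0 : ℝ) 1
  hG : ∀ i, G i ∈ Set.Ioc (0 : ℝ) 1
  hf_pos : ∀ i, ∀ d ∈ N.D, ∀ z ∈ Set.Ioc (0 : ℝ) (N.a i),
    0 < N.f i d z ∧ N.f i d z < z
  hf_cont : ∀ i, ∀ d ∈ N.D, ContinuousOn (N.f i d) (Set.Icc 0 (δ i))
  hf_mono : ∀ i, ∀ d ∈ N.D, StrictMonoOn (N.f i d) (Set.Icc 0 (δ i))
  hlip_low : ∀ i, ∀ d ∈ N.D, ∀ y ∈ Set.Icc (0 : ℝ) (δt i), ∀ z ∈ Set.Icc (0 : ℝ) (δt i),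
    L i * |z - y| ≤ |N.f i d z - N.f i d y|
  hlip_up : ∀ i, ∀ d ∈ N.D, ∀ y ∈ Set.Icc (0 : ℝ) (δ i), ∀ z ∈ Set.Icc (0 : ℝ) (δ i),
    |N.f i d z - N.f i d y| ≤ G i * |z - y|
  hfmin_pos : ∀ i, 0 < fmin i
  hfmin : ∀ i, ∀ d ∈ N.D, ∀ z ∈ Set.Icc (δ i) (N.a i), fmin i ≤ N.f i d z

/-- Assumption (H2): the turning-rate matrix is strictly upper triangular. -/
def Network.H2 {n l : ℕ} (N : Network n l) : Prop :=
  ∀ i j : Fin n, (j : ℕ) ≤ (i : ℕ) → N.p i j = 0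

/-- Assumption (H3): continuous positive-definite lower bounds `s̃ i` for the
congestion functions, and constants `vmax i > 0`, such that
`x i * s̃ i (d,x,v) = 0` for all `i` together with `v i < vmax i` for all `i`
imply `x = 0`. -/
structure H3 {n l : ℕ} (N : Network n l) where
  st : Fin n → (Fin l → ℝ) → (Fin n → ℝ) → (Fin n → ℝ) → ℝ
  vmax : Fin n → ℝ
  hvmax : ∀ i, 0 < vmax i
  hst_cont : ∀ i, ContinuousOn
    (fun q : (Fin l → ℝ) × (Fin n → ℝ) × (Fin n → ℝ) => st i q.1 q.2.1 q.2.2)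
    (N.D ×ˢ stateSet N.a ×ˢ {v | ∀ j, 0 ≤ v j})
  hst01 : ∀ i, ∀ d ∈ N.D, ∀ x ∈ stateSet N.a, ∀ v : Fin n → ℝ, (∀ j, 0 ≤ v j) →
    st i d x v ∈ Set.Icc (0 : ℝ) 1
  hst_le : ∀ i, ∀ d ∈ N.D, ∀ x ∈ stateSet N.a, ∀ v : Fin n → ℝ, (∀ j, 0 ≤ v j) →
    st i d x v ≤ N.s i d x v
  himp : ∀ d ∈ N.D, ∀ x ∈ stateSet N.a, ∀ v : Fin n → ℝ, (∀ j, 0 ≤ v j) →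
    (∀ i, x i * st i d x v = 0) → (∀ i, v i < vmax i) → x = 0

/-- Assumption (H4): there exist `μ i ∈ (0, δt i)` such that whenever `x ≤ μ`,
`vmax i + ∑ j, p j i * f j (x j) ≤ g i (d, x)` for every `i`. -/
structure H4 {n l : ℕ} (N : Network n l) (δt vmax : Fin n → ℝ) where
  μ : Fin n → ℝ
  hμ : ∀ i, μ i ∈ Set.Ioo (0 : ℝ) (δt i)
  hsupply : ∀ i, ∀ d ∈ N.D, ∀ x ∈ stateSet N.a, (∀ j, x j ≤ μ j) →
    vmax i + ∑ j, N.p j i * N.f j d (x j) ≤ N.g i d x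

/-- `min { g i (d, 0) : d ∈ D }` (as an infimum). -/
noncomputable def Network.gmin {n l : ℕ} (N : Network n l) (i : Fin n) : ℝ :=
  sInf ((fun d => N.g i d 0) '' N.D)

/-- The feedback law (3.3):
`v = v* − diag(v* − b) (1ₙ − h(1ₙ − τ⁻¹ K h(x − x*)))`. -/
noncomputable def feedback {n : ℕ} (vstar b : Fin n → ℝ)
    (K : Matrix (Fin n) (Fin n) ℝ) (τ : ℝ) (xstar x : Fin n → ℝ) : Fin n → ℝ :=
  fun i => vstar i - (vstar i - b i) *
    (1 - max 0 (1 - τ⁻¹ * ∑ j, K i j * max 0 (x j - xstar j)))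

/-- `x : ℕ → ℝⁿ` is a solution of the closed-loop system (2.9) with (3.3) for the
disturbance sequence `d`. -/
def IsClosedLoopSolution {n l : ℕ} (N : Network n l) (vstar b : Fin n → ℝ)
    (K : Matrix (Fin n) (Fin n) ℝ) (τ : ℝ) (xstar : Fin n → ℝ)
    (d : ℕ → Fin l → ℝ) (x : ℕ → Fin n → ℝ) : Prop :=
  ∀ t, x (t + 1) = N.update (d t) (x t) (feedback vstar b K τ xstar (x t))

theorem exists_pos_lowerBound {n : ℕ} (g : Fin n → ℝ) (hg : ∀ i, 0 < g i) :
    ∃ m : ℝ, 0 < m ∧ ∀ i, m ≤ g i := by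
  rcases isEmpty_or_nonempty (Fin n) with h | h
  · exact ⟨1, one_pos, fun i => h.elim i⟩
  · obtain ⟨i, hi⟩ := Finite.exists_min g
    exact ⟨g i, hg i, hi⟩

theorem euclNorm_le_sum_abs {n : ℕ} (y : Fin n → ℝ) : euclNorm y ≤ ∑ i, |y i| := by
  have h0 : 0 ≤ ∑ i, |y i| := Finset.sum_nonneg fun i _ => abs_nonneg _
  refine (Real.sqrt_le_left h0).2 ?_
  simpa [sq_abs] using
    Finset.sum_sq_le_sq_sum_of_nonneg (s := Finset.univ) fun i _ => abs_nonneg (y i)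

theorem sum_abs_le_mul_euclNorm {n : ℕ} (y : Fin n → ℝ) :
    ∑ i, |y i| ≤ n * euclNorm y := by
  have h : ∀ i ∈ Finset.univ, |y i| ≤ euclNorm y := fun i hi =>
    Real.abs_le_sqrt (Finset.single_le_sum (f := fun j => y j ^ 2)
      (fun j _ => sq_nonneg _) hi)
  simpa using Finset.sum_le_sum h

theorem feedback_bounds {n : ℕ} {vstar b : Fin n → ℝ} {K : Matrix (Fin n) (Fin n) ℝ} {τ : ℝ}
    (hb : ∀ i, b i ≤ vstar i) (hK : ∀ i j, 0 ≤ K i j) (hτ : 0 < τ)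
    (xstar x : Fin n → ℝ) (i : Fin n) :
    b i ≤ feedback vstar b K τ xstar x i ∧ feedback vstar b K τ xstar x i ≤ vstar i ∧
    vstar i - feedback vstar b K τ xstar x i ≤
      (vstar i - b i) * (τ⁻¹ * ∑ j, K i j * max 0 (x j - xstar j)) := by
  unfold feedback
  set q := τ⁻¹ * ∑ j, K i j * max 0 (x j - xstar j)
  have hq : 0 ≤ q := mul_nonneg (inv_nonneg.2 hτ.le)
    (Finset.sum_nonneg fun j _ => mul_nonneg (hK i j) (le_max_left _ _))
  have hbi := sub_nonneg.2 (hb i)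
  have h1 : 0 ≤ 1 - max 0 (1 - q) := by
    rw [sub_nonneg]; exact max_le zero_le_one (by linarith)
  have h2 : 1 - max 0 (1 - q) ≤ 1 := by linarith [le_max_left 0 (1 - q)]
  have h3 : 1 - max 0 (1 - q) ≤ q := by linarith [le_max_right 0 (1 - q)]
  have e1 := mul_nonneg hbi h1
  have e2 := mul_le_mul_of_nonneg_left h2 hbi
  have e3 := mul_le_mul_of_nonneg_left h3 hbi
  exact ⟨by linarith, by linarith, by linarith⟩

/-- The feedback saturates at `b` once its gain term reaches one. -/
theorem feedback_eq_of_one_le {n : ℕ} {vstar b : Fin n → ℝ} {K : Matrix (Fin n) (Fin n) ℝ}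
    {τ : ℝ} {xstar x : Fin n → ℝ} {i : Fin n}
    (h : 1 ≤ τ⁻¹ * ∑ j, K i j * max 0 (x j - xstar j)) :
    feedback vstar b K τ xstar x i = b i := by
  unfold feedback
  rw [max_eq_left (by linarith)]
  ring

theorem isCompact_stateSet {n : ℕ} (a : Fin n → ℝ) : IsCompact (stateSet a) := by
  have h : stateSet a = Set.pi Set.univ fun i => Set.Icc 0 (a i) := by
    ext x; simp only [stateSet, Set.mem_ofPred_eq, Set.mem_univ_pi]
  rw [h]
  exact isCompact_univ_pi fun i => isCompact_Icc

/-- Weights decreasing by one along the ordering of the cells. -/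
def cellWeight (n : ℕ) (i : Fin n) : ℝ := (n : ℝ) - (i : ℕ)

theorem one_le_cellWeight {n : ℕ} (i : Fin n) : 1 ≤ cellWeight n i := by
  have h : ((i : ℕ) : ℝ) + 1 ≤ n := by exact_mod_cast i.isLt
  unfold cellWeight; linarith

theorem cellWeight_pos {n : ℕ} (i : Fin n) : 0 < cellWeight n i :=
  one_pos.trans_le (one_le_cellWeight i)

theorem cellWeight_le {n : ℕ} (i : Fin n) : cellWeight n i ≤ n := by
  unfold cellWeight; linarith [Nat.cast_nonneg (α := ℝ) (i : ℕ)]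

namespace Network

variable {n l : ℕ} (N : Network n l)

theorem supply_le {d : Fin l → ℝ} (hd : d ∈ N.D) {x : Fin n → ℝ} (hx : x ∈ stateSet N.a)
    (i : Fin n) : N.g i d x ≤ N.a i - x i := by
  rcases lt_or_eq_of_le (hx i).2 with h | h
  · exact (N.hg_pos i d hd x hx h).2
  rw [h, sub_self]
  have ha := N.ha i
  have hmem : ∀ y ∈ Set.Icc 0 (N.a i), Function.update x i y ∈ stateSet N.a := by
    intro y hy j
    by_cases hj : j = i
    · subst hj; simpa using hy
    · simpa [hj] using hx j
  have hcont : ContinuousOn (fun y => N.g i d (Function.update x i y)) (Set.Icc 0 (N.a i)) := by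
    have hc : Continuous fun y : ℝ => (d, Function.update x i y) := by
      fun_prop
    exact (N.hg_cont i).comp hc.continuousOn fun y hy => ⟨hd, hmem y hy⟩
  have hcl : N.a i ∈ closure (Set.Ico 0 (N.a i)) := by
    rw [closure_Ico ha.ne]; exact ⟨ha.le, le_rfl⟩
  have hx' : Function.update x i (N.a i) = x := by rw [← h]; simp
  have key := closure_minimal (s := Set.Ico 0 (N.a i))
    (t := {y ∈ Set.Icc 0 (N.a i) | N.g i d (Function.update x i y) ≤ N.a i - y})
    (fun y hy => ⟨⟨hy.1, hy.2.le⟩, by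
      simpa using (N.hg_pos i d hd _ (hmem y ⟨hy.1, hy.2.le⟩) (by simpa using hy.2)).2⟩)
    (isClosed_Icc.isClosed_le hcont (by fun_prop)) hcl
  simpa [hx'] using key.2

theorem update_mem_stateSet {d : Fin l → ℝ} (hd : d ∈ N.D) {x : Fin n → ℝ}
    (hx : x ∈ stateSet N.a) {v : Fin n → ℝ} (hv : ∀ j, 0 ≤ v j) :
    N.update d x v ∈ stateSet N.a := by
  have hflow : ∀ j, 0 ≤ N.s j d x v * N.f j d (x j) := fun j =>
    mul_nonneg (N.hs01 j d hd x hx v hv).1 (N.hf_nonneg j d hd _ (hx j))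
  intro i
  have hf := N.hf_le i d hd _ (hx i)
  have h1 : N.s i d x v * N.f i d (x i) ≤ N.f i d (x i) :=
    mul_le_of_le_one_left (N.hf_nonneg i d hd _ (hx i)) (N.hs01 i d hd x hx v hv).2
  have h2 : 0 ≤ N.w i d x v * v i := mul_nonneg (N.hw01 i d hd x hx v hv).1 (hv i)
  have h3 : 0 ≤ ∑ j, N.p j i * (N.s j d x v * N.f j d (x j)) :=
    Finset.sum_nonneg fun j _ => mul_nonneg (N.hp_nonneg j i) (hflow j)
  have h4 := N.h27 i d hd x hx v hv
  have h5 := N.supply_le hd hx i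
  have h6 := hflow i
  simp only [update, Set.mem_Icc]
  constructor <;> linarith

theorem demand_zero {d : Fin l → ℝ} (hd : d ∈ N.D) (i : Fin n) : N.f i d 0 = 0 :=
  le_antisymm (N.hf_le i d hd 0 ⟨le_rfl, (N.ha i).le⟩)
    (N.hf_nonneg i d hd 0 ⟨le_rfl, (N.ha i).le⟩)

/-- The demand functions dominate a common linear function. -/
theorem exists_linear_le_demand (h1 : H1 N) :
    ∃ c : ℝ, 0 < c ∧ ∀ i, ∀ d ∈ N.D, ∀ z ∈ Set.Icc 0 (N.a i), c * z ≤ N.f i d z := by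
  have hδt := fun i => (h1.hδt i).1
  have hL := fun i => (h1.hL i).1
  obtain ⟨m, hm, hmle⟩ := exists_pos_lowerBound
    (fun i => min (h1.L i * h1.δt i / N.a i) (h1.fmin i / N.a i)) fun i =>
      lt_min (div_pos (mul_pos (hL i) (hδt i)) (N.ha i)) (div_pos (h1.hfmin_pos i) (N.ha i))
  refine ⟨m, hm, fun i d hd z hz => ?_⟩
  have ha := N.ha i
  have hδta : h1.δt i ≤ N.a i := (h1.hδt i).2.trans (h1.hδ i).2
  have hm1 : m * N.a i ≤ h1.L i * h1.δt i :=
    (le_div_iff₀ ha).1 ((hmle i).trans (min_le_left _ _))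
  have hm2 : m * N.a i ≤ h1.fmin i :=
    (le_div_iff₀ ha).1 ((hmle i).trans (min_le_right _ _))
  have hmz : m * z ≤ m * N.a i := mul_le_mul_of_nonneg_left hz.2 hm.le
  have hlow : ∀ y ∈ Set.Icc 0 (h1.δt i), h1.L i * y ≤ N.f i d y := by
    intro y hy
    have h := h1.hlip_low i d hd 0 ⟨le_rfl, (hδt i).le⟩ y hy
    rwa [N.demand_zero hd, sub_zero, sub_zero, abs_of_nonneg hy.1,
      abs_of_nonneg (N.hf_nonneg i d hd y ⟨hy.1, hy.2.trans hδta⟩)] at h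
  rcases le_total z (h1.δt i) with hzt | hzt
  · refine le_trans (mul_le_mul_of_nonneg_right ?_ hz.1) (hlow z ⟨hz.1, hzt⟩)
    refine le_of_mul_le_mul_right (hm1.trans ?_) ha
    exact mul_le_mul_of_nonneg_left hδta (hL i).le
  rcases le_total z (h1.δ i) with hzd | hzd
  · have h := (h1.hf_mono i d hd).monotoneOn ⟨(hδt i).le, (h1.hδt i).2⟩ ⟨hz.1, hzd⟩ hzt
    have h' := hlow _ ⟨(hδt i).le, le_rfl⟩
    linarith
  · linarith [h1.hfmin i d hd z ⟨hzd, hz.2⟩]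

variable {N}

theorem sum_turning_mul_cellWeight_le (h2 : N.H2) (i : Fin n) :
    ∑ j, N.p i j * cellWeight n j ≤ cellWeight n i - 1 := by
  have hw := one_le_cellWeight i
  have hterm : ∀ j, N.p i j * cellWeight n j ≤ N.p i j * (cellWeight n i - 1) := by
    intro j
    rcases le_or_gt (j : ℕ) (i : ℕ) with h | h
    · simp [h2 i j h]
    · refine mul_le_mul_of_nonneg_left ?_ (N.hp_nonneg i j)
      have h' : ((i : ℕ) : ℝ) + 1 ≤ (j : ℕ) := by exact_mod_cast h
      unfold cellWeight; linarith
  calc ∑ j, N.p i j * cellWeight n j ≤ ∑ j, N.p i j * (cellWeight n i - 1) :=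
        Finset.sum_le_sum fun j _ => hterm j
    _ = (∑ j, N.p i j) * (cellWeight n i - 1) := by rw [Finset.sum_mul]
    _ ≤ cellWeight n i - 1 :=
        mul_le_of_le_one_left (by linarith) (by linarith [N.hpQ i, N.hQ_nonneg i])

/-- Routing a non-negative flow downstream loses at least its total in weighted mass. -/
theorem sum_cellWeight_mul_route_le (h2 : N.H2) {q : Fin n → ℝ} (hq : ∀ i, 0 ≤ q i) :
    ∑ i, cellWeight n i * (∑ j, N.p j i * q j - q i) ≤ -∑ i, q i := by
  have h : ∑ i, cellWeight n i * ∑ j, N.p j i * q j =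
      ∑ j, q j * ∑ i, N.p j i * cellWeight n i := by
    simp_rw [Finset.mul_sum]
    rw [Finset.sum_comm]
    exact Finset.sum_congr rfl fun j _ => Finset.sum_congr rfl fun i _ => by ring
  have h' := Finset.sum_le_sum fun j (_ : j ∈ Finset.univ) =>
    mul_le_mul_of_nonneg_left (sum_turning_mul_cellWeight_le h2 j) (hq j)
  have h'' : ∑ j, q j * (cellWeight n j - 1) = ∑ j, cellWeight n j * q j - ∑ j, q j := by
    rw [← Finset.sum_sub_distrib]
    exact Finset.sum_congr rfl fun j _ => by ring
  simp_rw [mul_sub]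
  rw [Finset.sum_sub_distrib]
  linarith

/-- One update raises the weighted mass by at most the inflow, minus the total actual outflow. -/
theorem sum_cellWeight_mul_update_le (h2 : N.H2) {d : Fin l → ℝ} (hd : d ∈ N.D)
    {x : Fin n → ℝ} (hx : x ∈ stateSet N.a) {v : Fin n → ℝ} (hv : ∀ j, 0 ≤ v j) :
    ∑ i, cellWeight n i * N.update d x v i ≤ ∑ i, cellWeight n i * x i
      + ∑ i, cellWeight n i * v i - ∑ i, N.s i d x v * N.f i d (x i) := by
  have h := sum_cellWeight_mul_route_le h2 (q := fun i => N.s i d x v * N.f i d (x i))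
    fun j => mul_nonneg (N.hs01 j d hd x hx v hv).1 (N.hf_nonneg j d hd _ (hx j))
  have hle : ∑ i, cellWeight n i * N.update d x v i ≤ ∑ i, (cellWeight n i * x i
      + cellWeight n i * v i + cellWeight n i * (∑ j, N.p j i *
        (N.s j d x v * N.f j d (x j)) - N.s i d x v * N.f i d (x i))) := by
    refine Finset.sum_le_sum fun i _ => ?_
    rw [← mul_add, ← mul_add]
    refine mul_le_mul_of_nonneg_left ?_ (cellWeight_pos i).le
    have := mul_le_of_le_one_left (hv i) (N.hw01 i d hd x hx v hv).2
    unfold update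
    linarith
  rw [Finset.sum_add_distrib, Finset.sum_add_distrib] at hle
  linarith

/-- Near an uncongested equilibrium, weighted excesses decrease, and weighted deficits decrease up
to the inflow reduction. -/
theorem uncongested_step (h1 : H1 N) (h2 : N.H2) {ε : ℝ} (hε : ∀ i, ε ≤ h1.L i)
    {d : Fin l → ℝ} (hd : d ∈ N.D) {xs vs x v : Fin n → ℝ}
    (hxs : ∀ i, xs i ∈ Set.Icc 0 (h1.δt i)) (hx : ∀ i, x i ∈ Set.Icc 0 (h1.δt i))
    (heq : ∀ i, N.f i d (xs i) = vs i + ∑ j, N.p j i * N.f j d (xs j))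
    (hv : ∀ i, v i ≤ vs i)
    (hws : ∀ i, N.w i d x v = 1 ∧ N.s i d x v = 1) :
    ∑ i, cellWeight n i * max 0 (N.update d x v i - xs i) ≤
      ∑ i, cellWeight n i * max 0 (x i - xs i) - ε * ∑ i, max 0 (x i - xs i) ∧
    ∑ i, cellWeight n i * max 0 (xs i - N.update d x v i) ≤
      ∑ i, cellWeight n i * max 0 (xs i - x i) - ε * ∑ i, max 0 (xs i - x i)
        + ∑ i, cellWeight n i * (vs i - v i) := by
  set φ : Fin n → ℝ := fun i => N.f i d (x i) - N.f i d (xs i) with hφ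
  set α : Fin n → ℝ := fun i => max 0 (φ i) with hα
  set β : Fin n → ℝ := fun i => max 0 (-φ i) with hβ
  have hα0 : ∀ i, 0 ≤ α i := fun i => le_max_left _ _
  have hβ0 : ∀ i, 0 ≤ β i := fun i => le_max_left _ _
  have hαβ : ∀ i, φ i = α i - β i := by
    intro i
    simp only [hα, hβ]
    rcases le_total 0 (φ i) with h | h
    · rw [max_eq_right h, max_eq_left (by linarith)]; ring
    · rw [max_eq_left h, max_eq_right (by linarith)]; ring
  have hcmp : ∀ i, ε * max 0 (x i - xs i) ≤ α i ∧ α i ≤ max 0 (x i - xs i) ∧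
      ε * max 0 (xs i - x i) ≤ β i ∧ β i ≤ max 0 (xs i - x i) := by
    intro i
    have hle := (h1.hδt i).2
    have hxd : x i ∈ Set.Icc 0 (h1.δ i) := ⟨(hx i).1, (hx i).2.trans hle⟩
    have hxsd : xs i ∈ Set.Icc 0 (h1.δ i) := ⟨(hxs i).1, (hxs i).2.trans hle⟩
    have hlow : ε * |x i - xs i| ≤ |φ i| :=
      (mul_le_mul_of_nonneg_right (hε i) (abs_nonneg _)).trans
        (h1.hlip_low i d hd _ (hxs i) _ (hx i))
    have hup : |φ i| ≤ |x i - xs i| := (h1.hlip_up i d hd _ hxsd _ hxd).trans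
      (mul_le_of_le_one_left (abs_nonneg _) (h1.hG i).2)
    rcases le_total (xs i) (x i) with h | h
    · have hφi : 0 ≤ φ i := sub_nonneg.2 ((h1.hf_mono i d hd).monotoneOn hxsd hxd h)
      rw [abs_of_nonneg hφi, abs_of_nonneg (sub_nonneg.2 h)] at hlow hup
      simp only [hα, hβ]
      rw [max_eq_right hφi, max_eq_right (sub_nonneg.2 h), max_eq_left (neg_nonpos.2 hφi),
        max_eq_left (sub_nonpos.2 h)]
      exact ⟨hlow, hup, by simp, le_rfl⟩
    · have hφi : φ i ≤ 0 := sub_nonpos.2 ((h1.hf_mono i d hd).monotoneOn hxd hxsd h)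
      rw [abs_of_nonpos hφi, abs_of_nonpos (sub_nonpos.2 h), neg_sub (x i) (xs i)] at hlow hup
      simp only [hα, hβ]
      rw [max_eq_left hφi, max_eq_left (sub_nonpos.2 h), max_eq_right (neg_nonneg.2 hφi),
        max_eq_right (sub_nonneg.2 h)]
      exact ⟨by simp, le_rfl, hlow, hup⟩
  have hupd : ∀ i, N.update d x v i - xs i =
      x i - xs i - φ i + ∑ j, N.p j i * φ j + (v i - vs i) := by
    intro i
    have hs : ∑ j, N.p j i * φ j =
        ∑ j, N.p j i * N.f j d (x j) - ∑ j, N.p j i * N.f j d (xs j) := by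
      simp only [hφ, mul_sub, Finset.sum_sub_distrib]
    have := heq i
    simp only [update, (hws _).1, (hws _).2, one_mul, hs]
    simp only [hφ]
    linarith
  have hsplit : ∀ i, ∑ j, N.p j i * φ j = ∑ j, N.p j i * α j - ∑ j, N.p j i * β j := by
    intro i
    rw [← Finset.sum_sub_distrib]
    exact Finset.sum_congr rfl fun j _ => by rw [hαβ j]; ring
  have hsα : ∀ i, 0 ≤ ∑ j, N.p j i * α j := fun i =>
    Finset.sum_nonneg fun j _ => mul_nonneg (N.hp_nonneg j i) (hα0 j)
  have hsβ : ∀ i, 0 ≤ ∑ j, N.p j i * β j := fun i =>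
    Finset.sum_nonneg fun j _ => mul_nonneg (N.hp_nonneg j i) (hβ0 j)
  have hpos : ∀ i, x i - xs i = max 0 (x i - xs i) - max 0 (xs i - x i) := by
    intro i
    rcases le_total (xs i) (x i) with h | h
    · rw [max_eq_right (sub_nonneg.2 h), max_eq_left (sub_nonpos.2 h)]; ring
    · rw [max_eq_left (sub_nonpos.2 h), max_eq_right (sub_nonneg.2 h)]; ring
  have hP : ∀ i, max 0 (N.update d x v i - xs i) ≤
      max 0 (x i - xs i) + (∑ j, N.p j i * α j - α i) := by
    intro i
    obtain ⟨_, c2, _, c4⟩ := hcmp i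
    have := hsα i
    have := hsβ i
    refine max_le (by linarith) ?_
    rw [hupd i, hsplit i, hαβ i]
    linarith [hv i, hpos i]
  have hN : ∀ i, max 0 (xs i - N.update d x v i) ≤
      max 0 (xs i - x i) + (∑ j, N.p j i * β j - β i) + (vs i - v i) := by
    intro i
    obtain ⟨_, c2, _, c4⟩ := hcmp i
    have := hsα i
    have := hsβ i
    refine max_le (by linarith [hv i]) ?_
    rw [← neg_sub, hupd i, hsplit i, hαβ i]
    linarith [hv i, hpos i]
  have rα := sum_cellWeight_mul_route_le h2 hα0
  have rβ := sum_cellWeight_mul_route_le h2 hβ0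
  have lα : ε * ∑ i, max 0 (x i - xs i) ≤ ∑ i, α i := by
    rw [Finset.mul_sum]; exact Finset.sum_le_sum fun i _ => (hcmp i).1
  have lβ : ε * ∑ i, max 0 (xs i - x i) ≤ ∑ i, β i := by
    rw [Finset.mul_sum]; exact Finset.sum_le_sum fun i _ => (hcmp i).2.2.1
  have sP := Finset.sum_le_sum fun i (_ : i ∈ Finset.univ) =>
    mul_le_mul_of_nonneg_left (hP i) (cellWeight_pos i).le
  have sN := Finset.sum_le_sum fun i (_ : i ∈ Finset.univ) =>
    mul_le_mul_of_nonneg_left (hN i) (cellWeight_pos i).le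
  simp only [mul_add, Finset.sum_add_distrib] at sP sN
  constructor <;> linarith

/-- Away from the origin, the total actual outflow is bounded below, uniformly over bounded
inflows. -/
theorem exists_outflow_lowerBound (h1 : H1 N) (h3 : H3 N) {vs : Fin n → ℝ}
    (hvs : ∀ i, vs i < h3.vmax i) {T : Set (Fin n → ℝ)} (hT : IsClosed T)
    (h0 : (0 : Fin n → ℝ) ∉ T) :
    ∃ m : ℝ, 0 < m ∧ ∀ d ∈ N.D, ∀ x ∈ stateSet N.a, x ∈ T → ∀ v ∈ Set.Icc 0 vs,
      m ≤ ∑ i, N.s i d x v * N.f i d (x i) := by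
  obtain ⟨c, hc, hcf⟩ := N.exists_linear_le_demand h1
  set Ω : Set ((Fin l → ℝ) × (Fin n → ℝ) × (Fin n → ℝ)) :=
    N.D ×ˢ (stateSet N.a ∩ T) ×ˢ Set.Icc 0 vs
  have hΩ : IsCompact Ω :=
    N.hD_compact.prod (((isCompact_stateSet N.a).inter_right hT).prod isCompact_Icc)
  have hcont : ContinuousOn (fun q : (Fin l → ℝ) × (Fin n → ℝ) × (Fin n → ℝ) =>
      ∑ i, q.2.1 i * h3.st i q.1 q.2.1 q.2.2) Ω := by
    refine continuousOn_finsetSum _ fun i _ => ContinuousOn.mul (by fun_prop) ?_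
    exact (h3.hst_cont i).mono fun q hq => ⟨hq.1, hq.2.1.1, fun j => hq.2.2.1 j⟩
  have hnn : ∀ q ∈ Ω, ∀ i, 0 ≤ q.2.1 i * h3.st i q.1 q.2.1 q.2.2 := fun q hq i =>
    mul_nonneg (hq.2.1.1 i).1 (h3.hst01 i _ hq.1 _ hq.2.1.1 _ fun j => hq.2.2.1 j).1
  have hpos : ∀ q ∈ Ω, 0 < ∑ i, q.2.1 i * h3.st i q.1 q.2.1 q.2.2 := by
    intro q hq
    refine lt_of_le_of_ne (Finset.sum_nonneg fun i _ => hnn q hq i) fun h => h0 ?_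
    have hz := (Finset.sum_eq_zero_iff_of_nonneg fun i _ => hnn q hq i).1 h.symm
    rw [← h3.himp _ hq.1 _ hq.2.1.1 q.2.2 (fun j => hq.2.2.1 j)
      (fun i => hz i (Finset.mem_univ i)) fun i => (hq.2.2.2 i).trans_lt (hvs i)]
    exact hq.2.1.2
  obtain ⟨m, hm, hmle⟩ : ∃ m : ℝ, 0 < m ∧ ∀ q ∈ Ω,
      m ≤ ∑ i, q.2.1 i * h3.st i q.1 q.2.1 q.2.2 := by
    rcases Ω.eq_empty_or_nonempty with h | h
    · exact ⟨1, one_pos, by simp [h]⟩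
    · obtain ⟨q, hq, hmin⟩ := hΩ.exists_isMinOn h hcont
      exact ⟨_, hpos q hq, fun q' hq' => hmin hq'⟩
  refine ⟨c * m, mul_pos hc hm, fun d hd x hx hxT v hv => ?_⟩
  refine (mul_le_mul_of_nonneg_left (hmle (d, x, v) ⟨hd, ⟨hx, hxT⟩, hv⟩) hc.le).trans ?_
  rw [Finset.mul_sum]
  refine Finset.sum_le_sum fun i _ => ?_
  have hv0 : ∀ j, 0 ≤ v j := fun j => hv.1 j
  calc c * (x i * h3.st i d x v) = h3.st i d x v * (c * x i) := by ring
    _ ≤ N.s i d x v * N.f i d (x i) :=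
      mul_le_mul (h3.hst_le i d hd x hx v hv0) (hcf i d hd _ (hx i))
        (mul_nonneg hc.le (hx i).1) (N.hs01 i d hd x hx v hv0).1

end Network

/-- Exponential decay from a functional `W` that drops by a fixed amount outside the invariant set
`{U ≤ u₀}` and a functional `V` that contracts inside it. -/
theorem exists_exponential_decay_of_two_stage {E : Type*} {S : Set E} {z U V W : E → ℝ}
    {u₀ η θ B A c r : ℝ} (hη : 0 < η) (hθ : 0 < θ) (hB : 0 < B) (hA : 0 ≤ A) (hc : 0 < c)
    (hr : 0 < r) (hz : ∀ x ∈ S, 0 ≤ z x) (hzV : ∀ x ∈ S, z x ≤ V x)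
    (hVz : ∀ x ∈ S, V x ≤ c * z x) (hVB : ∀ x ∈ S, V x ≤ B)
    (hW : ∀ x ∈ S, 0 ≤ W x) (hWA : ∀ x ∈ S, W x ≤ A)
    (hout : ∀ x ∈ S, u₀ < U x → r ≤ z x) :
    ∃ M σ : ℝ, 0 < M ∧ 0 < σ ∧ ∀ x : ℕ → E, (∀ t, x t ∈ S) →
      (∀ t, U (x t) ≤ u₀ → U (x (t + 1)) ≤ u₀ ∧ V (x (t + 1)) ≤ V (x t) - θ * V (x t)) →
      (∀ t, u₀ < U (x t) → W (x (t + 1)) ≤ W (x t) - η) →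
      ∀ t : ℕ, z (x t) ≤ M * Real.exp (-σ * t) * z (x 0) := by
  classical
  have hAB : 0 < A + B := by linarith
  set Φ : E → ℝ := fun x => if U x ≤ u₀ then V x else W x + B with hΦ
  set σ := min θ (η / (A + B)) with hσ
  have hσ0 : 0 < σ := lt_min hθ (div_pos hη hAB)
  have hzΦ : ∀ x ∈ S, z x ≤ Φ x := by
    intro x hx
    simp only [hΦ]
    split_ifs
    · exact hzV x hx
    · linarith [hzV x hx, hVB x hx, hW x hx]
  have hΦz : ∀ x ∈ S, Φ x ≤ (c + (A + B) / r) * z x := by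
    intro x hx
    have hq : 0 ≤ (A + B) / r := (div_pos hAB hr).le
    simp only [hΦ]
    split_ifs with h
    · linarith [hVz x hx, mul_nonneg hq (hz x hx)]
    · have h' := mul_le_mul_of_nonneg_left (hout x hx (not_le.1 h)) hq
      rw [div_mul_cancel₀ _ hr.ne'] at h'
      linarith [hWA x hx, mul_nonneg hc.le (hz x hx)]
  refine ⟨c + (A + B) / r, σ, add_pos hc (div_pos hAB hr), hσ0, fun x hxS hin hdrop t => ?_⟩
  have hstep : ∀ t, Φ (x (t + 1)) ≤ Φ (x t) - σ * Φ (x t) := by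
    intro t
    by_cases h : U (x t) ≤ u₀
    · have hV0 := (hz _ (hxS t)).trans (hzV _ (hxS t))
      simp only [hΦ, if_pos h, if_pos (hin t h).1]
      linarith [(hin t h).2, mul_le_mul_of_nonneg_right (min_le_left θ (η / (A + B))) hV0]
    · have h1 := hdrop t (not_le.1 h)
      have h2 : σ * (W (x t) + B) ≤ η := by
        calc σ * (W (x t) + B) ≤ η / (A + B) * (A + B) := by
              refine mul_le_mul (min_le_right _ _) (by linarith [hWA _ (hxS t)])
                (by linarith [hW _ (hxS t)]) (div_pos hη hAB).le
          _ = η := div_mul_cancel₀ _ hAB.ne'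
      have h3 := hW _ (hxS (t + 1))
      have h4 := hVB _ (hxS (t + 1))
      simp only [hΦ, if_neg h]
      split_ifs <;> linarith
  have hdecay : Φ (x t) ≤ Real.exp (-σ * t) * Φ (x 0) := by
    induction t with
    | zero => simp
    | succ t ih =>
      have hΦ0 := (hz _ (hxS t)).trans (hzΦ _ (hxS t))
      calc Φ (x (t + 1)) ≤ (-σ + 1) * Φ (x t) := by linarith [hstep t]
        _ ≤ Real.exp (-σ) * Φ (x t) :=
          mul_le_mul_of_nonneg_right (Real.add_one_le_exp _) hΦ0
        _ ≤ Real.exp (-σ) * (Real.exp (-σ * t) * Φ (x 0)) :=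
          mul_le_mul_of_nonneg_left ih (Real.exp_pos _).le
        _ = Real.exp (-σ * (t + 1 : ℕ)) * Φ (x 0) := by
          rw [← mul_assoc, ← Real.exp_add]
          congr 2
          push_cast
          ring
  calc z (x t) ≤ Φ (x t) := hzΦ _ (hxS t)
    _ ≤ Real.exp (-σ * t) * Φ (x 0) := hdecay
    _ ≤ Real.exp (-σ * t) * ((c + (A + B) / r) * z (x 0)) :=
      mul_le_mul_of_nonneg_left (hΦz _ (hxS 0)) (Real.exp_pos _).le
    _ = _ := by ring

/-- **Theorem 3.2.** Under (H1), (H2), (H3), (H4), assume the existence of an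
uncongested equilibrium point `x*` with `x* i ∈ (0, μ i)` and
`v* i ∈ [0, min(vmax i, min{g i (d,0) : d ∈ D}))` satisfying (3.1). Then there
exist an index set `R ⊆ {i : v* i > 0}`, a non-negative matrix `K` and a vector
`b ∈ ℝ₊ⁿ` with `0 < b i < v* i` for `i ∈ R` and `b i = v* i` for `i ∉ R`, such
that for every `τ ∈ (0,1)` the equilibrium `x*` is Robustly Globally
Exponentially Stable for the closed-loop system (2.9) with (3.3): there exist
`M, σ > 0` such that every solution with initial condition in `S` and any
disturbance sequence in `D` satisfies `|x(t) − x*| ≤ M exp(−σ t) |x(0) − x*|`. -/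
theorem stmt13 {n l : ℕ} (hn : 1 ≤ n) (N : Network n l)
    (h1 : H1 N) (h2 : N.H2) (h3 : H3 N) (h4 : H4 N h1.δt h3.vmax)
    (xstar vstar : Fin n → ℝ)
    (hxstar : ∀ i, xstar i ∈ Set.Ioo 0 (h4.μ i))
    (hvstar_nonneg : ∀ i, 0 ≤ vstar i)
    (hvstar : ∀ i, vstar i < min (h3.vmax i) (N.gmin i))
    (heq : ∀ d ∈ N.D, ∀ i,
      N.f i d (xstar i) = vstar i + ∑ j, N.p j i * N.f j d (xstar j)) :
    ∃ R : Finset (Fin n), (∀ i ∈ R, 0 < vstar i) ∧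
      ∃ K : Matrix (Fin n) (Fin n) ℝ, (∀ i j, 0 ≤ K i j) ∧
      ∃ b : Fin n → ℝ,
        (∀ i ∈ R, 0 < b i ∧ b i < vstar i) ∧ (∀ i ∉ R, b i = vstar i) ∧
        ∀ τ ∈ Set.Ioo (0 : ℝ) 1,
        ∃ M σ : ℝ, 0 < M ∧ 0 < σ ∧
          ∀ d : ℕ → Fin l → ℝ, (∀ t, d t ∈ N.D) →
          ∀ x : ℕ → Fin n → ℝ, x 0 ∈ stateSet N.a →
          IsClosedLoopSolution N vstar b K τ xstar d x →
          ∀ t : ℕ, euclNorm (x t - xstar) ≤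
            M * Real.exp (-σ * t) * euclNorm (x 0 - xstar) := by
  have hn0 : (1 : ℝ) ≤ n := by exact_mod_cast hn
  have hvmax : ∀ i, vstar i < h3.vmax i := fun i => (hvstar i).trans_le (min_le_left _ _)
  have hμδ : ∀ i, h4.μ i ≤ h1.δt i := fun i => (h4.hμ i).2.le
  obtain ⟨ε, hε, hεL⟩ := exists_pos_lowerBound h1.L fun i => (h1.hL i).1
  obtain ⟨u₀, hu₀, hu₀μ⟩ := exists_pos_lowerBound (fun i => h4.μ i - xstar i)
    fun i => sub_pos.2 (hxstar i).2
  set P : (Fin n → ℝ) → ℝ := fun y => ∑ i, max 0 (y i - xstar i) with hP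
  set Q : (Fin n → ℝ) → ℝ := fun y => ∑ i, max 0 (xstar i - y i) with hQ
  set U : (Fin n → ℝ) → ℝ := fun y => ∑ i, cellWeight n i * max 0 (y i - xstar i) with hU
  set Y : (Fin n → ℝ) → ℝ := fun y => ∑ i, cellWeight n i * max 0 (xstar i - y i) with hY
  set W : (Fin n → ℝ) → ℝ := fun y => ∑ i, cellWeight n i * y i with hW
  set z : (Fin n → ℝ) → ℝ := fun y => ∑ i, |(y - xstar) i| with hz
  have hweight : ∀ q : Fin n → ℝ, (∀ i, 0 ≤ q i) →
      ∑ i, q i ≤ ∑ i, cellWeight n i * q i ∧ ∑ i, cellWeight n i * q i ≤ n * ∑ i, q i := by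
    intro q hq
    rw [Finset.mul_sum]
    exact ⟨Finset.sum_le_sum fun i _ => le_mul_of_one_le_left (hq i) (one_le_cellWeight i),
      Finset.sum_le_sum fun i _ => mul_le_mul_of_nonneg_right (cellWeight_le i) (hq i)⟩
  have hPU : ∀ y, P y ≤ U y ∧ U y ≤ n * P y := fun y => hweight _ fun i => le_max_left _ _
  have hQY : ∀ y, Q y ≤ Y y ∧ Y y ≤ n * Q y := fun y => hweight _ fun i => le_max_left _ _
  have hP0 : ∀ y, 0 ≤ P y := fun y => Finset.sum_nonneg fun i _ => le_max_left _ _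
  have hQ0 : ∀ y, 0 ≤ Q y := fun y => Finset.sum_nonneg fun i _ => le_max_left _ _
  have hzPQ : ∀ y, z y = P y + Q y := by
    intro y
    simp only [hz, hP, hQ, ← Finset.sum_add_distrib, Pi.sub_apply]
    refine Finset.sum_congr rfl fun i _ => ?_
    rcases le_total (xstar i) (y i) with h | h
    · rw [max_eq_right (sub_nonneg.2 h), max_eq_left (sub_nonpos.2 h), add_zero,
        abs_of_nonneg (sub_nonneg.2 h)]
    · rw [max_eq_left (sub_nonpos.2 h), max_eq_right (sub_nonneg.2 h), zero_add,
        abs_of_nonpos (sub_nonpos.2 h), neg_sub]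
  have hUμ : ∀ y, U y ≤ u₀ → ∀ i, y i ≤ h4.μ i := by
    intro y hy i
    have h5 : max 0 (y i - xstar i) ≤ P y :=
      Finset.single_le_sum (f := fun i => max 0 (y i - xstar i))
        (fun j _ => le_max_left _ _) (Finset.mem_univ i)
    linarith [le_max_right 0 (y i - xstar i), (hPU y).1, hu₀μ i]
  obtain ⟨m, hm, hmle⟩ := Network.exists_outflow_lowerBound h1 h3 hvmax
    (T := {y | u₀ ≤ U y}) (isClosed_le continuous_const (by fun_prop)) (by
      have h0 : U 0 = 0 := Finset.sum_eq_zero fun i _ => by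
        rw [Pi.zero_apply, max_eq_left (by linarith [(hxstar i).1]), mul_zero]
      simpa [h0] using hu₀)
  set F := ∑ i, cellWeight n i * vstar i with hF
  have hF0 : 0 ≤ F := Finset.sum_nonneg fun i _ =>
    mul_nonneg (cellWeight_pos i).le (hvstar_nonneg i)
  obtain ⟨ρ, hρ0, hρ1, hρF⟩ : ∃ ρ : ℝ, 0 < ρ ∧ ρ < 1 ∧ ρ * F ≤ m / 2 := by
    refine ⟨min (1 / 2) (m / 2 / (F + 1)), by positivity,
      (min_le_left _ _).trans_lt (by norm_num), ?_⟩
    calc _ ≤ m / 2 / (F + 1) * (F + 1) :=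
          mul_le_mul (min_le_right _ _) (by linarith) hF0 (by positivity)
      _ = m / 2 := div_mul_cancel₀ _ (by positivity)
  have hκ : 0 < (n : ℝ) / u₀ := by positivity
  have hb : ∀ i, ρ * vstar i ≤ vstar i := fun i =>
    mul_le_of_le_one_left (hvstar_nonneg i) hρ1.le
  have hb0 : ∀ i, 0 ≤ ρ * vstar i := fun i => mul_nonneg hρ0.le (hvstar_nonneg i)
  refine ⟨Finset.univ.filter fun i => 0 < vstar i, by simp, Matrix.of fun _ _ => n / u₀,
    fun i j => hκ.le, fun i => ρ * vstar i, ?_, ?_, ?_⟩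
  · intro i hi
    have hi' : 0 < vstar i := by simpa using hi
    exact ⟨mul_pos hρ0 hi', mul_lt_of_lt_one_left hi' hρ1⟩
  · intro i hi
    have hi' : vstar i ≤ 0 := by simpa using hi
    simp [le_antisymm hi' (hvstar_nonneg i)]
  intro τ hτ
  have hτi : 1 ≤ τ⁻¹ := (one_le_inv₀ hτ.1).2 hτ.2.le
  set v : (Fin n → ℝ) → Fin n → ℝ := fun y =>
    feedback vstar (fun i => ρ * vstar i) (Matrix.of fun _ _ => n / u₀) τ xstar y with hv
  have hgain : ∀ y (i : Fin n), τ⁻¹ * ∑ j, (Matrix.of fun _ _ => (n : ℝ) / u₀ :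
      Matrix (Fin n) (Fin n) ℝ) i j * max 0 (y j - xstar j) = τ⁻¹ * (n / u₀) * P y := by
    intro y i
    simp only [Matrix.of_apply, hP, ← Finset.mul_sum, mul_assoc]
  have hvb : ∀ y i, ρ * vstar i ≤ v y i ∧ v y i ≤ vstar i ∧
      vstar i - v y i ≤ vstar i * (τ⁻¹ * (n / u₀) * P y) := by
    intro y i
    obtain ⟨e1, e2, e3⟩ := feedback_bounds (K := Matrix.of fun _ _ => (n : ℝ) / u₀) hb
      (fun i j => hκ.le) hτ.1 xstar y i
    refine ⟨e1, e2, e3.trans ?_⟩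
    rw [hgain]
    refine mul_le_mul_of_nonneg_right (by linarith [hb0 i]) ?_
    have := hP0 y
    have := hτ.1
    positivity
  have hv0 : ∀ y i, 0 ≤ v y i := fun y i => (hb0 i).trans (hvb y i).1
  set κ := F * (τ⁻¹ * (n / u₀)) with hκdef
  have hκ0 : 0 ≤ κ := mul_nonneg hF0 (by positivity)
  set C := 1 + 2 * κ / ε with hC
  have hC1 : 1 ≤ C := by
    have : 0 ≤ 2 * κ / ε := by positivity
    linarith
  have hCε : ε * C = ε + 2 * κ := by
    rw [hC]; field_simp
  set A := ∑ i, N.a i with hA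
  have : Nonempty (Fin n) := ⟨⟨0, hn⟩⟩
  have hA0 : 0 < A := Finset.sum_pos (fun i _ => N.ha i) Finset.univ_nonempty
  have hxsa : ∀ i, xstar i ≤ N.a i := fun i =>
    (hxstar i).2.le.trans ((hμδ i).trans ((h1.hδt i).2.trans (h1.hδ i).2))
  have hzA : ∀ y ∈ stateSet N.a, z y ≤ A := by
    intro y hy
    refine Finset.sum_le_sum fun i _ => abs_le.2 ⟨?_, ?_⟩
    · simp only [Pi.sub_apply]; linarith [(hy i).1, hxsa i]
    · simp only [Pi.sub_apply]; linarith [(hy i).2, (hxstar i).1]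
  have hVz : ∀ y, C * U y + Y y ≤ n * C * z y := by
    intro y
    have e1 := mul_le_mul_of_nonneg_left (hPU y).2 (zero_le_one.trans hC1)
    have e2 := (hQY y).2
    have e3 : n * Q y ≤ n * C * Q y :=
      mul_le_mul_of_nonneg_right (le_mul_of_one_le_right (by linarith) hC1) (hQ0 y)
    rw [hzPQ]
    linarith
  obtain ⟨M, σ, hM, hσ, hdecay⟩ := exists_exponential_decay_of_two_stage (S := stateSet N.a)
    (z := z) (U := U) (V := fun y => C * U y + Y y) (W := W) (u₀ := u₀) (η := m / 2)
    (θ := ε / (2 * n)) (B := n * C * A) (A := n * A) (c := n * C) (r := u₀ / n)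
    (by positivity) (by positivity) (by positivity) (by positivity) (by positivity)
    (by positivity)
    (fun y _ => by linarith [hzPQ y, hP0 y, hQ0 y])
    (fun y _ => by
      have := le_mul_of_one_le_left ((hP0 y).trans (hPU y).1) hC1
      linarith [hzPQ y, (hPU y).1, (hQY y).1])
    (fun y _ => hVz y)
    (fun y hy => (hVz y).trans (mul_le_mul_of_nonneg_left (hzA y hy) (by positivity)))
    (fun y hy => Finset.sum_nonneg fun i _ => mul_nonneg (cellWeight_pos i).le (hy i).1)
    (fun y hy => (hweight y fun i => (hy i).1).2.trans
      (mul_le_mul_of_nonneg_left (Finset.sum_le_sum fun i _ => (hy i).2) (by positivity)))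
    (fun y _ h => by
      rw [div_le_iff₀ (by positivity)]
      have := mul_nonneg (Nat.cast_nonneg (α := ℝ) n) (hQ0 y)
      have := (hPU y).2
      rw [hzPQ]
      linarith)
  refine ⟨M * n, σ, by positivity, hσ, fun d hd x hx0 hsol t => ?_⟩
  have hsol' : ∀ t, x (t + 1) = N.update (d t) (x t) (v (x t)) := hsol
  have hxS : ∀ t, x t ∈ stateSet N.a := by
    intro t
    induction t with
    | zero => exact hx0
    | succ t ih => rw [hsol']; exact N.update_mem_stateSet (hd t) ih (hv0 _)
  have key := hdecay x hxS ?_ ?_ t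
  · calc euclNorm (x t - xstar) ≤ z (x t) := euclNorm_le_sum_abs _
      _ ≤ M * Real.exp (-σ * t) * z (x 0) := key
      _ ≤ M * Real.exp (-σ * t) * (n * euclNorm (x 0 - xstar)) :=
        mul_le_mul_of_nonneg_left (sum_abs_le_mul_euclNorm _) (by positivity)
      _ = M * n * Real.exp (-σ * t) * euclNorm (x 0 - xstar) := by ring
  · intro t ht
    have hxμ := hUμ _ ht
    have hws := N.h28 (d t) (hd t) (x t) (hxS t) (v (x t)) (hv0 _) fun i => by
      have := h4.hsupply i (d t) (hd t) (x t) (hxS t) hxμ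
      linarith [(hvb (x t) i).2.1, hvmax i]
    have hst := Network.uncongested_step h1 h2 hεL (hd t)
      (fun i => ⟨(hxstar i).1.le, (hxstar i).2.le.trans (hμδ i)⟩)
      (fun i => ⟨(hxS t i).1, (hxμ i).trans (hμδ i)⟩)
      (heq _ (hd t)) (fun i => (hvb (x t) i).2.1) hws
    rw [← hsol'] at hst
    have hUst : U (x (t + 1)) ≤ U (x t) - ε * P (x t) := hst.1
    have hYst : Y (x (t + 1)) ≤ Y (x t) - ε * Q (x t)
        + ∑ i, cellWeight n i * (vstar i - v (x t) i) := hst.2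
    have hred : ∑ i, cellWeight n i * (vstar i - v (x t) i) ≤ κ * P (x t) := by
      rw [hκdef, hF, mul_assoc, Finset.sum_mul]
      refine Finset.sum_le_sum fun i _ => ?_
      rw [mul_assoc]
      exact mul_le_mul_of_nonneg_left (hvb (x t) i).2.2 (cellWeight_pos i).le
    have hεP := mul_nonneg hε.le (hP0 (x t))
    have hεQ := mul_nonneg hε.le (hQ0 (x t))
    refine ⟨by linarith, ?_⟩
    have e1 := mul_le_mul_of_nonneg_left hUst (zero_le_one.trans hC1)
    have e2 : C * (U (x t) - ε * P (x t)) = C * U (x t) - (ε + 2 * κ) * P (x t) := by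
      rw [← hCε]; ring
    have e3 : ε / (2 * n) * (C * U (x t) + Y (x t)) ≤ ε / (2 * n) * (C * (n * P (x t))
        + n * Q (x t)) := mul_le_mul_of_nonneg_left (add_le_add
          (mul_le_mul_of_nonneg_left (hPU _).2 (zero_le_one.trans hC1)) (hQY _).2)
          (by positivity)
    have e4 : ε / (2 * n) * (C * (n * P (x t)) + n * Q (x t)) =
        ((ε + 2 * κ) * P (x t) + ε * Q (x t)) / 2 := by
      rw [← hCε]; field_simp
    linarith
  · intro t ht
    have hsat : v (x t) = fun i => ρ * vstar i := by
      funext i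
      refine feedback_eq_of_one_le ?_
      rw [hgain, mul_assoc]
      have h6 : 1 ≤ n / u₀ * P (x t) := by
        rw [div_mul_eq_mul_div, one_le_div hu₀]
        exact ht.le.trans (hPU _).2
      exact one_le_mul_of_one_le_of_one_le hτi h6
    have hmass := Network.sum_cellWeight_mul_update_le h2 (hd t) (hxS t) (hv0 (x t))
    rw [← hsol'] at hmass
    have hdrain := hmle (d t) (hd t) (x t) (hxS t) ht.le (v (x t))
      ⟨hv0 _, fun i => (hvb (x t) i).2.1⟩
    have hin : ∑ i, cellWeight n i * v (x t) i = ρ * F := by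
      rw [hsat, hF, Finset.mul_sum]
      exact Finset.sum_congr rfl fun i _ => by ring
    show ∑ i, cellWeight n i * x (t + 1) i ≤ ∑ i, cellWeight n i * x t i - m / 2
    linarith
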